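/- Let n ≥ 2 and s ≥ n+3. Let P ∈ L = L_{n,d}(m_1,…,m_s), let I ⊆ {1,…,s}, let t ≥ 0 be an integer, and set k := k_{I,t} = Σ_{i∈I} m_i + t·k_C − (t+|I|−1)·d. Then for any pairwise distinct u_1,…,u_t ∈ ℂ and any vector q in the ℂ-linear span of {p_i : i ∈ I} ∪ {(1, u_j, u_j², …, u_j^n) : 1 ≤ j ≤ t}, every partial derivative of P of total order strictly less than k vanishes at q. (Geometrically: the join J(L_I, σ_t) of the linear span of the points indexed by I with the t-secant variety of the rational normal curve C is contained in the base locus of |D| with multiplicity at least max(k,0).) -/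

import Mathlib

open Finset

noncomputable section

/-- Binomial coefficient `C(a,k)` with integer arguments; zero if `k < 0` or `a < k`. -/
def Cb (a k : ℤ) : ℤ := if 0 ≤ k ∧ k ≤ a then (Nat.choose a.toNat k.toNat : ℤ) else 0

/-- Iterated partial derivative along a list of coordinate directions, as a linear map. -/
def derivAlong {n : ℕ} (D : List (Fin (n+1))) :
    MvPolynomial (Fin (n+1)) ℂ →ₗ[ℂ] MvPolynomial (Fin (n+1)) ℂ :=
  D.foldr (fun j f => (MvPolynomial.pderiv j).toLinearMap.comp f) LinearMap.id

/-- The point `(1, u, u², …, uⁿ) ∈ ℂ^{n+1}` on the affine cone over the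
rational normal curve of degree `n`. -/
def rncPoint (n : ℕ) (u : ℂ) : Fin (n+1) → ℂ := fun j => u ^ (j : ℕ)

/-- The linear system `L_{n,d}(m_1,…,m_s)`: homogeneous polynomials of degree `d`
in `x_0,…,x_n` all of whose partial derivatives of total order `≤ m_i − 1`
vanish at the point `p_i = (1, t_i, …, t_iⁿ)`. -/
def linSys (n d s : ℕ) (m : Fin s → ℕ) (tp : Fin s → ℂ) :
    Submodule ℂ (MvPolynomial (Fin (n+1)) ℂ) :=
  MvPolynomial.homogeneousSubmodule (Fin (n+1)) ℂ d ⊓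
    ⨅ (i : Fin s), ⨅ (D : List (Fin (n+1))), ⨅ (_ : D.length < m i),
      LinearMap.ker
        ((MvPolynomial.aeval (rncPoint n (tp i))).toLinearMap.comp (derivAlong D))

/-- `k_C = ⌈(m_1+⋯+m_s − nd)/(s−n−2)⌉`. -/
def kC (n d s : ℕ) (m : Fin s → ℕ) : ℤ :=
  ⌈((∑ i, (m i : ℚ)) - (n : ℚ) * d) / ((s : ℚ) - n - 2)⌉


open MvPolynomial in
theorem pd_comm {σ : Type*} (i j : σ) (Q : MvPolynomial σ ℂ) :
    pderiv i (pderiv j Q) = pderiv j (pderiv i Q) := by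
  classical
  have h : ⁅(pderiv i : Derivation ℂ (MvPolynomial σ ℂ) (MvPolynomial σ ℂ)),
      (pderiv j : Derivation ℂ (MvPolynomial σ ℂ) (MvPolynomial σ ℂ))⁆ = 0 := by
    apply MvPolynomial.derivation_ext
    intro k
    rw [Derivation.commutator_apply]
    simp only [pderiv_X, Pi.single_apply]
    split_ifs <;> simp
  have h2 := congrArg (fun D => D Q) h
  simp only [Derivation.commutator_apply] at h2
  exact sub_eq_zero.mp h2

/-- Recursive version of "vanishing to order `k` at `φ`". -/
def Van {n : ℕ} {A : Type} [CommRing A] [Algebra ℂ A] (φ : Fin (n+1) → A) :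
    ℕ → MvPolynomial (Fin (n+1)) ℂ → Prop
  | 0, _ => True
  | k+1, Q => MvPolynomial.aeval φ Q = 0 ∧ ∀ i, Van φ k (MvPolynomial.pderiv i Q)

section van
open MvPolynomial
variable {n : ℕ} {A : Type} [CommRing A] [Algebra ℂ A] (φ : Fin (n+1) → A)

theorem Van.anti {k : ℕ} : ∀ {l : ℕ} {Q : MvPolynomial (Fin (n+1)) ℂ}, l ≤ k → Van φ k Q → Van φ l Q := by
  induction k with
  | zero => intro l Q h _; obtain rfl : l = 0 := by omega
            trivial
  | succ k ih =>
    intro l Q h hV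
    cases l with
    | zero => trivial
    | succ l => exact ⟨hV.1, fun i => ih (by omega) (hV.2 i)⟩

theorem Van.pd {k : ℕ} {Q : MvPolynomial (Fin (n+1)) ℂ} (h : Van φ k Q) (i) :
    Van φ (k-1) (pderiv i Q) := by
  cases k with
  | zero => trivial
  | succ k => exact h.2 i

theorem Van.zero (k : ℕ) : Van φ k 0 := by
  induction k with
  | zero => trivial
  | succ k ih => exact ⟨by simp, fun i => by simpa using ih⟩

theorem Van.add {k : ℕ} : ∀ {P Q : MvPolynomial (Fin (n+1)) ℂ}, Van φ k P → Van φ k Q → Van φ k (P+Q) := by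
  induction k with
  | zero => intros; trivial
  | succ k ih =>
    intro P Q hP hQ
    exact ⟨by rw [map_add, hP.1, hQ.1, add_zero], fun i => by
      rw [map_add]; exact ih (hP.2 i) (hQ.2 i)⟩

theorem Van.smul {k : ℕ} (c : ℂ) : ∀ {P : MvPolynomial (Fin (n+1)) ℂ}, Van φ k P → Van φ k (c • P) := by
  induction k with
  | zero => intros; trivial
  | succ k ih =>
    intro P hP
    exact ⟨by rw [map_smul, hP.1, smul_zero], fun i => by
      rw [Derivation.map_smul]; exact ih (hP.2 i)⟩

theorem Van.sum {k : ℕ} {ι : Type*} (S : Finset ι) (f : ι → MvPolynomial (Fin (n+1)) ℂ)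
    (h : ∀ i ∈ S, Van φ k (f i)) : Van φ k (∑ i ∈ S, f i) := by
  classical
  induction S using Finset.induction_on with
  | empty => simpa using Van.zero φ k
  | insert a S ha ih =>
    rw [Finset.sum_insert ha]
    exact Van.add φ (h a (by simp)) (ih fun i hi => h i (by simp [hi]))

theorem derivAlong_cons (i : Fin (n+1)) (D : List (Fin (n+1))) (Q) :
    derivAlong (i :: D) Q = pderiv i (derivAlong D Q) := rfl

theorem derivAlong_pderiv (i : Fin (n+1)) (D : List (Fin (n+1))) (Q) :
    derivAlong D (pderiv i Q) = pderiv i (derivAlong D Q) := by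
  induction D with
  | nil => rfl
  | cons j D ih => rw [derivAlong_cons, derivAlong_cons, ih, pd_comm]

theorem van_iff (k : ℕ) : ∀ (Q : MvPolynomial (Fin (n+1)) ℂ),
    Van φ k Q ↔ ∀ D : List (Fin (n+1)), D.length < k → aeval φ (derivAlong D Q) = 0 := by
  induction k with
  | zero => intro Q; simp [Van]
  | succ k ih =>
    intro Q
    constructor
    · rintro ⟨h1, h2⟩ D hD
      cases D with
      | nil => exact h1
      | cons i D =>
        have := (ih _).1 (h2 i) D (by simpa using hD)
        rwa [derivAlong_pderiv] at this
    · intro h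
      refine ⟨h [] (by simp), fun i => (ih _).2 fun D hD => ?_⟩
      rw [derivAlong_pderiv]
      exact h (i :: D) (by simpa using hD)

theorem euler_at {e : ℕ} {Q : MvPolynomial (Fin (n+1)) ℂ} (hQ : Q.IsHomogeneous e) :
    ∑ i, φ i * aeval φ (pderiv i Q) = e * aeval φ Q := by
  have := congrArg (aeval φ) hQ.sum_X_mul_pderiv
  simpa using this

end van

section join
open MvPolynomial
variable {n : ℕ}

theorem hom_zero_pderiv {Q : MvPolynomial (Fin (n+1)) ℂ} (hQ : Q.IsHomogeneous 0) (i) :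
    pderiv i Q = 0 := by
  rw [← totalDegree_zero_iff_isHomogeneous, totalDegree_eq_zero_iff_eq_C] at hQ
  rw [hQ, pderiv_C]

theorem pd_sum_smul (q : Fin (n+1) → ℂ) (Q : MvPolynomial (Fin (n+1)) ℂ) (j) :
    pderiv j (∑ i, q i • pderiv i Q) = ∑ i, q i • pderiv i (pderiv j Q) := by
  rw [map_sum]
  refine Finset.sum_congr rfl fun i _ => ?_
  rw [Derivation.map_smul, pd_comm]

theorem van_radial (q : Fin (n+1) → ℂ) (a : ℕ) : ∀ (e : ℕ) (Q : MvPolynomial (Fin (n+1)) ℂ),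
    Q.IsHomogeneous e → Van q a Q → Van q a (∑ i, q i • pderiv i Q) := by
  induction a with
  | zero => intros; trivial
  | succ a ih =>
    intro e Q hQ hV
    refine ⟨?_, fun j => ?_⟩
    · have := euler_at q hQ
      rw [hV.1, mul_zero] at this
      rw [map_sum, ← this]
      simp
    · rw [pd_sum_smul]
      exact ih _ _ hQ.pderiv (hV.2 j)

theorem hom_dir (q : Fin (n+1) → ℂ) {e : ℕ} {Q : MvPolynomial (Fin (n+1)) ℂ}
    (hQ : Q.IsHomogeneous e) : (∑ i, q i • pderiv i Q).IsHomogeneous (e-1) :=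
  (homogeneousSubmodule _ _ _).sum_mem fun _ _ => (homogeneousSubmodule _ _ _).smul_mem _ hQ.pderiv

theorem van_dir (q v : Fin (n+1) → ℂ) {b : ℕ} {Q : MvPolynomial (Fin (n+1)) ℂ}
    (hQ : Van v b Q) : Van v (b-1) (∑ i, q i • pderiv i Q) :=
  Van.sum _ _ _ fun _ _ => Van.smul _ _ (hQ.pd _ _)

theorem join_eval (q v : Fin (n+1) → ℂ) (c : ℂ) (e : ℕ) : ∀ (a b : ℕ)
    (Q : MvPolynomial (Fin (n+1)) ℂ), Q.IsHomogeneous e → Van q a Q → Van v b Q → e < a + b →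
    aeval (q + c • v) Q = 0 := by
  induction e with
  | zero =>
    intro a b Q hQ ha hb hab
    rw [← totalDegree_zero_iff_isHomogeneous, totalDegree_eq_zero_iff_eq_C] at hQ
    rw [hQ] at ha hb ⊢
    rcases a with _ | a
    · rcases b with _ | b
      · omega
      · simpa using hb.1
    · simpa using ha.1
  | succ e ih =>
    intro a b Q hQ ha hb hab
    have h1 := ih a (b-1) _ (hom_dir q hQ) (van_radial q a _ _ hQ ha) (van_dir q v hb) (by omega)
    have h2 := ih (a-1) b _ (hom_dir v hQ) (van_dir v q ha) (van_radial v b _ _ hQ hb) (by omega)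
    have h3 := euler_at (q + c • v) hQ
    have h4 : ∑ i, (q + c • v) i * aeval (q + c • v) (pderiv i Q) =
        aeval (q + c • v) (∑ i, q i • pderiv i Q) + c * aeval (q + c • v) (∑ i, v i • pderiv i Q) := by
      rw [map_sum, map_sum, Finset.mul_sum, ← Finset.sum_add_distrib]
      refine Finset.sum_congr rfl fun i _ => ?_
      simp only [map_smul, smul_eq_mul, Pi.add_apply, Pi.smul_apply]
      ring
    rw [h4, h1, h2] at h3
    simp only [mul_zero, add_zero] at h3
    rcases mul_eq_zero.mp h3.symm with h | h
    · exact absurd h (Nat.cast_ne_zero.mpr (by omega))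
    · exact h

theorem join_van (q v : Fin (n+1) → ℂ) (c : ℂ) (N : ℕ) : ∀ (e a b : ℕ)
    (Q : MvPolynomial (Fin (n+1)) ℂ), Q.IsHomogeneous e → Van q a Q → Van v b Q → N + e ≤ a + b →
    Van (q + c • v) N Q := by
  induction N with
  | zero => intros; trivial
  | succ N ih =>
    intro e a b Q hQ ha hb hab
    refine ⟨join_eval q v c e a b Q hQ ha hb (by omega), fun i => ?_⟩
    rcases e with _ | e
    · rw [hom_zero_pderiv hQ]; exact Van.zero _ _
    · exact ih e (a-1) (b-1) _ hQ.pderiv (ha.pd _ i) (hb.pd _ i) (by omega)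

theorem van_origin (d : ℕ) : ∀ (Q : MvPolynomial (Fin (n+1)) ℂ), Q.IsHomogeneous d →
    Van (0 : Fin (n+1) → ℂ) d Q := by
  induction d with
  | zero => intros; trivial
  | succ d ih =>
    intro Q hQ
    refine ⟨?_, fun i => ih _ hQ.pderiv⟩
    have h3 := euler_at (0 : Fin (n+1) → ℂ) hQ
    simp only [Pi.zero_apply, zero_mul, Finset.sum_const_zero] at h3
    rcases mul_eq_zero.mp h3.symm with h | h
    · exact absurd h (Nat.cast_ne_zero.mpr (by omega))
    · exact h

theorem join_sum {ι : Type*} (S : Finset ι) (v : ι → Fin (n+1) → ℂ) (c : ι → ℂ) (b : ι → ℤ)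
    {d : ℕ} {Q : MvPolynomial (Fin (n+1)) ℂ} (hQ : Q.IsHomogeneous d)
    (hv : ∀ i ∈ S, Van (v i) (b i).toNat Q) (q : Fin (n+1) → ℂ) (k : ℤ) (hq : Van q k.toNat Q) :
    Van (q + ∑ i ∈ S, c i • v i) (k + ∑ i ∈ S, b i - S.card * d).toNat Q := by
  classical
  induction S using Finset.induction_on with
  | empty => simpa using hq
  | insert x S hx ih =>
    have h := ih fun i hi => hv i (by simp [hi])
    have hx' := hv x (by simp)
    rw [Finset.sum_insert hx, Finset.sum_insert hx, Finset.card_insert_of_notMem hx]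
    rw [show q + (c x • v x + ∑ i ∈ S, c i • v i) = (q + ∑ i ∈ S, c i • v i) + c x • v x by abel]
    set K := k + ∑ i ∈ S, b i - S.card * d with hK
    rw [show k + (b x + ∑ i ∈ S, b i) - ((S.card + 1 : ℕ) : ℤ) * d = K + b x - d by
      rw [hK]; push_cast; ring]
    by_cases h0 : K + b x - d ≤ 0
    · rw [Int.toNat_of_nonpos h0]; trivial
    · exact join_van _ _ _ _ d _ _ Q hQ h hx' (by omega)

end join

section curve
open Polynomial
variable {n : ℕ}

/-- The generic point of the rational normal curve. -/
def gen (n : ℕ) : Fin (n+1) → ℂ[X] := fun i => X ^ (i : ℕ)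

/-- Iterated directional derivative, restricted to the curve. -/
def BB : List (Fin (n+1) → ℂ[X]) → MvPolynomial (Fin (n+1)) ℂ → ℂ[X]
  | [], Q => MvPolynomial.aeval (gen n) Q
  | w :: ws, Q => ∑ i, w i * BB ws (MvPolynomial.pderiv i Q)

theorem chain (Q : MvPolynomial (Fin (n+1)) ℂ) :
    derivative (MvPolynomial.aeval (gen n) Q) =
      ∑ i, derivative (gen n i) * MvPolynomial.aeval (gen n) (MvPolynomial.pderiv i Q) := by
  classical
  induction Q using MvPolynomial.induction_on with
  | C a => simp
  | add p q hp hq => simp only [map_add, hp, hq, mul_add, Finset.sum_add_distrib]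
  | mul_X p j hp =>
    have key : ∀ i, derivative (gen n i) *
        MvPolynomial.aeval (gen n) (MvPolynomial.pderiv i (p * MvPolynomial.X j)) =
        derivative (gen n i) * MvPolynomial.aeval (gen n) (MvPolynomial.pderiv i p) * gen n j +
        (if i = j then MvPolynomial.aeval (gen n) p * derivative (gen n j) else 0) := by
      intro i
      rw [MvPolynomial.pderiv_mul, map_add, map_mul, map_mul, MvPolynomial.aeval_X]
      by_cases h : i = j
      · subst h
        rw [MvPolynomial.pderiv_X_self, map_one, if_pos rfl]; ring
      · rw [MvPolynomial.pderiv_X_of_ne (Ne.symm h), map_zero, if_neg h]; ring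
    rw [Finset.sum_congr rfl fun i _ => key i, Finset.sum_add_distrib, ← Finset.sum_mul, ← hp,
      Finset.sum_ite_eq' Finset.univ j, if_pos (Finset.mem_univ j), map_mul, derivative_mul,
      MvPolynomial.aeval_X]

theorem tang0 (ws : List (Fin (n+1) → ℂ[X])) : ∀ (e : ℕ) (Q : MvPolynomial (Fin (n+1)) ℂ),
    Q.IsHomogeneous e → Van (gen n) (ws.length + 1) Q →
    ∑ i, gen n i * BB ws (MvPolynomial.pderiv i Q) = 0 := by
  induction ws with
  | nil =>
    intro e Q hQ hV
    simp only [BB]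
    rw [euler_at _ hQ, hV.1, mul_zero]
  | cons w ws ih =>
    intro e Q hQ hV
    simp only [BB, Finset.mul_sum]
    rw [Finset.sum_comm]
    refine Finset.sum_eq_zero fun j _ => ?_
    have := ih _ _ (hQ.pderiv (i := j)) (hV.2 j)
    rw [← mul_zero (w j), ← this, Finset.mul_sum]
    refine Finset.sum_congr rfl fun i _ => ?_
    rw [pd_comm]; ring

theorem tang1 (ws : List (Fin (n+1) → ℂ[X])) : ∀ (Q : MvPolynomial (Fin (n+1)) ℂ),
    Van (gen n) (ws.length + 1) Q →
    ∑ i, derivative (gen n i) * BB ws (MvPolynomial.pderiv i Q) = 0 := by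
  induction ws with
  | nil =>
    intro Q hV
    simp only [BB]
    rw [← chain, hV.1, derivative_zero]
  | cons w ws ih =>
    intro Q hV
    simp only [BB, Finset.mul_sum]
    rw [Finset.sum_comm]
    refine Finset.sum_eq_zero fun j _ => ?_
    have := ih _ (hV.2 j)
    rw [← mul_zero (w j), ← this, Finset.mul_sum]
    refine Finset.sum_congr rfl fun i _ => ?_
    rw [pd_comm]; ring

/-- Constant point of the curve. -/
def cpt (n : ℕ) (x : ℂ) : Fin (n+1) → ℂ[X] := fun i => C x ^ (i : ℕ)

theorem exists_rem (n : ℕ) (x : ℂ) : ∃ r : Fin (n+1) → ℂ[X], ∀ i,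
    cpt n x i = gen n i + (C x - X) * derivative (gen n i) + (X - C x) ^ 2 * r i := by
  have : ∀ i : Fin (n+1), ∃ r : ℂ[X],
    cpt n x i = gen n i + (C x - X) * derivative (gen n i) + (X - C x) ^ 2 * r := by
    intro i
    obtain ⟨k, hk⟩ := Polynomial.binomExpansion (X ^ (i : ℕ) : ℂ[X][X]) X (C x - X)
    refine ⟨k, ?_⟩
    simp only [eval_pow, eval_X, derivative_X_pow, eval_mul, add_sub_cancel] at hk
    simp only [cpt, gen, hk, derivative_X_pow]
    simp
    ring
  choose r hr using this
  exact ⟨r, hr⟩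

theorem dvd_sq (xs : List ℂ) : ∀ (e : ℕ) (Q : MvPolynomial (Fin (n+1)) ℂ),
    Q.IsHomogeneous e → Van (gen n) xs.length Q →
    (xs.map fun x => (X - C x) ^ 2).prod ∣ BB (xs.map (cpt n)) Q := by
  induction xs with
  | nil => intros; simp
  | cons x xs ih =>
    intro e Q hQ hV
    obtain ⟨r, hr⟩ := exists_rem n x
    have h0 := tang0 (xs.map (cpt n)) e Q hQ (by simpa using hV)
    have h1 := tang1 (xs.map (cpt n)) Q (by simpa using hV)
    have : BB ((x :: xs).map (cpt n)) Q =
        (X - C x) ^ 2 * ∑ i, r i * BB (xs.map (cpt n)) (MvPolynomial.pderiv i Q) := by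
      simp only [List.map_cons, BB, hr, add_mul, Finset.sum_add_distrib, h0, zero_add, mul_assoc]
      rw [← Finset.mul_sum, h1, ← Finset.mul_sum]; simp
    rw [this, List.map_cons, List.prod_cons]
    exact mul_dvd_mul_left _ (Finset.dvd_sum fun i _ =>
      Dvd.dvd.mul_left (ih _ _ hQ.pderiv (hV.2 i)) _)

theorem eval_gen (τ : ℂ) (Q : MvPolynomial (Fin (n+1)) ℂ) :
    eval τ (MvPolynomial.aeval (gen n) Q) = MvPolynomial.aeval (rncPoint n τ) Q := by
  rw [← Polynomial.coe_aeval_eq_eval, ← AlgHom.comp_apply]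
  congr 1
  apply MvPolynomial.algHom_ext
  intro i
  simp [gen, rncPoint]

theorem dvd_of_derivative {τ : ℂ} {N : ℕ} {g : ℂ[X]} (h0 : eval τ g = 0)
    (h : (X - C τ) ^ N ∣ derivative g) : (X - C τ) ^ (N+1) ∣ g := by
  by_cases hg : g = 0
  · simp [hg]
  by_cases hd : derivative g = 0
  · exfalso
    have := Polynomial.natDegree_eq_zero_of_derivative_eq_zero hd
    rw [Polynomial.eq_C_of_natDegree_eq_zero this] at h0 hg
    simp at h0
    simp [h0] at hg
  have h1 := derivative_rootMultiplicity_of_root (p := g) (t := τ) h0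
  have h2 := (le_rootMultiplicity_iff hd).2 h
  have h3 := (rootMultiplicity_pos hg).2 h0
  exact (le_rootMultiplicity_iff hg).1 (by omega)

theorem dvd_pt (τ : ℂ) (N : ℕ) : ∀ (Q : MvPolynomial (Fin (n+1)) ℂ),
    Van (rncPoint n τ) N Q → (X - C τ) ^ N ∣ MvPolynomial.aeval (gen n) Q := by
  induction N with
  | zero => intros; simp
  | succ N ih =>
    intro Q hV
    apply dvd_of_derivative
    · rw [eval_gen, hV.1]
    · rw [chain]
      exact Finset.dvd_sum fun i _ => Dvd.dvd.mul_left (ih _ (hV.2 i)) _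

theorem dvd_ptB (τ : ℂ) (ws : List (Fin (n+1) → ℂ[X])) : ∀ (N : ℕ)
    (Q : MvPolynomial (Fin (n+1)) ℂ),
    Van (rncPoint n τ) N Q → (X - C τ) ^ (N - ws.length) ∣ BB ws Q := by
  induction ws with
  | nil => intro N Q h; exact dvd_pt τ N Q h
  | cons w ws ih =>
    intro N Q h
    refine Finset.dvd_sum fun i _ => Dvd.dvd.mul_left ?_ _
    have := ih _ _ (h.pd _ i)
    rwa [List.length_cons, show N - (ws.length + 1) = N - 1 - ws.length by omega]

theorem deg_gen {e : ℕ} {Q : MvPolynomial (Fin (n+1)) ℂ} (hQ : Q.IsHomogeneous e) :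
    (MvPolynomial.aeval (gen n) Q).natDegree ≤ n * e := by
  rw [MvPolynomial.aeval_def, MvPolynomial.eval₂_eq']
  apply natDegree_sum_le_of_forall_le
  intro s hs
  have hs' := hQ (MvPolynomial.mem_support_iff.mp hs)
  rw [Finsupp.weight_apply, Finsupp.sum_fintype _ _ (by simp)] at hs'
  simp only [Pi.one_apply, smul_eq_mul, mul_one] at hs'
  simp only [gen, ← pow_mul]
  rw [Finset.prod_pow_eq_pow_sum]
  refine (natDegree_C_mul_X_pow_le _ _).trans ?_
  rw [← hs', Finset.mul_sum]
  exact Finset.sum_le_sum fun i _ => Nat.mul_le_mul_right _ (by omega)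

theorem deg_B (xs : List ℂ) : ∀ (e : ℕ) (Q : MvPolynomial (Fin (n+1)) ℂ),
    Q.IsHomogeneous e → (BB (xs.map (cpt n)) Q).natDegree ≤ n * (e - xs.length) := by
  induction xs with
  | nil => intro e Q hQ; exact deg_gen hQ
  | cons x xs ih =>
    intro e Q hQ
    refine natDegree_sum_le_of_forall_le _ _ fun i _ => ?_
    have := ih _ _ (hQ.pderiv (i := i))
    rw [List.length_cons, show e - (xs.length + 1) = e - 1 - xs.length by omega]
    simp only [cpt, ← C_pow]
    exact (natDegree_C_mul_le _ _).trans this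

theorem van_succ (T : Set ℂ) (hT : T.Finite) (k : ℕ) : ∀ (Q : MvPolynomial (Fin (n+1)) ℂ),
    Van (gen n) k Q →
    (∀ xs : List ℂ, xs.length = k → (∀ x ∈ xs, x ∉ T) → BB (xs.map (cpt n)) Q = 0) →
    Van (gen n) (k+1) Q := by
  induction k with
  | zero => intro Q _ h; exact ⟨h [] rfl (by simp), fun i => trivial⟩
  | succ k ih =>
    intro Q hV h
    refine ⟨hV.1, fun i => ih _ (hV.2 i) fun xs hl hx => ?_⟩
    let f : ℂ[X][X] := ∑ j : Fin (n+1), C (BB (xs.map (cpt n)) (MvPolynomial.pderiv j Q)) * X ^ (j:ℕ)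
    have hf : f = 0 := by
      apply eq_zero_of_infinite_isRoot
      have : (C '' Tᶜ : Set ℂ[X]).Infinite := (hT.infinite_compl).image C_injective.injOn
      refine this.mono ?_
      rintro _ ⟨x, hxT, rfl⟩
      have := h (x :: xs) (by simp [hl]) (by
        intro y hy
        rcases List.mem_cons.mp hy with rfl | hy
        · exact hxT
        · exact hx y hy)
      simp only [List.map_cons, BB] at this
      simp only [Set.mem_ofPred_eq, IsRoot, f, eval_finsetSum, eval_mul, eval_C, eval_pow, eval_X]
      rw [← this]
      exact Finset.sum_congr rfl fun j _ => by rw [cpt]; ring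
    have := congrArg (fun g => coeff g (i : ℕ)) hf
    simp only [f, finsetSum_coeff, coeff_C_mul, coeff_X_pow, coeff_zero] at this
    rw [Finset.sum_eq_single i] at this
    · simpa using this
    · intro b _ hb
      have : (i : ℕ) ≠ b := fun h => hb (Fin.ext h.symm)
      simp [this]
    · simp

theorem monic_sqs (xs : List ℂ) : (xs.map fun x => ((X - C x) ^ 2 : ℂ[X])).prod.Monic := by
  induction xs with
  | nil => simp
  | cons x xs ih =>
    rw [List.map_cons, List.prod_cons]
    exact ((monic_X_sub_C x).pow 2).mul ih

theorem curve_step {d s : ℕ} (m : Fin s → ℕ) (tp : Fin s → ℂ) (htp : Function.Injective tp)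
    {P : MvPolynomial (Fin (n+1)) ℂ} (hP : P.IsHomogeneous d)
    (hm : ∀ i, Van (rncPoint n (tp i)) (m i) P) (k : ℕ) (hk : Van (gen n) k P)
    (hlt : n * (d - k) < 2 * k + ∑ i, (m i - k)) : Van (gen n) (k+1) P := by
  refine van_succ (Set.range tp) (Set.finite_range tp) k P hk fun xs hl hx => ?_
  have d1 := dvd_sq xs d P hP (hl ▸ hk)
  have d2 : ∏ i, (X - C (tp i)) ^ (m i - k) ∣ BB (xs.map (cpt n)) P := by
    apply Finset.prod_dvd_of_coprime
    · intro i _ j _ hij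
      exact (pairwise_coprime_X_sub_C htp hij).pow
    · intro i _
      have := dvd_ptB (tp i) (xs.map (cpt n)) (m i) P (hm i)
      rwa [List.length_map, hl] at this
  have cop : IsCoprime (xs.map fun x => (X - C x) ^ 2).prod (∏ i, (X - C (tp i)) ^ (m i - k)) := by
    apply IsCoprime.prod_right
    intro i _
    apply IsCoprime.pow_right
    clear d1 d2 hl
    induction xs with
    | nil => simpa using isCoprime_one_left
    | cons x xs ih =>
      rw [List.map_cons, List.prod_cons]
      refine IsCoprime.mul_left (IsCoprime.pow_left ?_) (ih fun y hy => hx y (by simp [hy]))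
      apply isCoprime_X_sub_C_of_isUnit_sub
      apply IsUnit.mk0
      intro h0
      exact hx x (by simp) ⟨i, (sub_eq_zero.mp h0).symm⟩
  have dd := cop.mul_dvd d1 d2
  by_contra hne
  have h1 := natDegree_le_of_dvd dd hne
  have h2 := deg_B xs d P hP
  have m1 : (xs.map fun x => (X - C x) ^ 2).prod.Monic := monic_sqs xs
  have m2 : (∏ i, (X - C (tp i)) ^ (m i - k)).Monic :=
    monic_prod_of_monic _ _ fun i _ => (monic_X_sub_C _).pow _
  rw [m1.natDegree_mul m2, natDegree_prod_of_monic _ _ fun i _ => (monic_X_sub_C _).pow _] at h1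
  have h3 : (xs.map fun x => (X - C x) ^ 2).prod.natDegree = 2 * xs.length := by
    clear * -
    induction xs with
    | nil => simp
    | cons x xs ih =>
      rw [List.map_cons, List.prod_cons, Monic.natDegree_mul ((monic_X_sub_C x).pow 2)
        (monic_sqs xs), ih]
      simp; ring
  rw [h3] at h1
  simp only [natDegree_pow, natDegree_X_sub_C, mul_one] at h1
  rw [hl] at h1 h2
  omega

theorem curve_van {d s : ℕ} (hs : n + 3 ≤ s) (m : Fin s → ℕ) (tp : Fin s → ℂ)
    (htp : Function.Injective tp)
    {P : MvPolynomial (Fin (n+1)) ℂ} (hP : P.IsHomogeneous d)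
    (hm : ∀ i, Van (rncPoint n (tp i)) (m i) P) (k : ℕ) (hk : (k : ℤ) ≤ kC n d s m) :
    Van (gen n) k P := by
  induction k with
  | zero => trivial
  | succ k ih =>
    refine curve_step m tp htp hP hm k (ih (by push_cast at hk; omega)) ?_
    have h1 : (k : ℤ) < kC n d s m := by push_cast at hk; omega
    rw [kC, Int.lt_ceil] at h1
    have hpos : (0 : ℚ) < (s : ℚ) - n - 2 := by
      have : ((n + 3 : ℕ) : ℚ) ≤ s := by exact_mod_cast hs
      push_cast at this; linarith
    rw [lt_div_iff₀ hpos] at h1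
    have h2 : (k : ℤ) * ((s : ℤ) - n - 2) < ∑ i, (m i : ℤ) - n * d := by
      exact_mod_cast h1
    rcases le_or_gt k d with hkd | hkd
    · have h3 : ∑ i, (m i : ℤ) - s * k ≤ ∑ i, ((m i - k : ℕ) : ℤ) := by
        have : ∑ i, (m i : ℤ) - s * k = ∑ i, ((m i : ℤ) - k) := by simp
        rw [this]
        exact Finset.sum_le_sum fun i _ => by omega
      zify [hkd]
      nlinarith
    · rw [Nat.sub_eq_zero_of_le hkd.le]
      omega

theorem van_spec (τ : ℂ) (k : ℕ) : ∀ (Q : MvPolynomial (Fin (n+1)) ℂ), Van (gen n) k Q →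
    Van (rncPoint n τ) k Q := by
  induction k with
  | zero => intros; trivial
  | succ k ih =>
    intro Q h
    exact ⟨by rw [← eval_gen, h.1, eval_zero], fun i => ih _ (h.2 i)⟩

end curve

/-- **Multiplicity of joins in the base locus (Corollary 1.4).** Every member of
`L = L_{n,d}(m_1,…,m_s)` vanishes to order at least `k_{I,t}` along the join
`J(L_I, σ_t)`: at every vector in the linear span of the points `p_i`, `i ∈ I`,
together with `t` arbitrary (distinct) points of the rational normal curve. -/
theorem stmt_5 (n d s : ℕ) (hn : 2 ≤ n) (hs : n + 3 ≤ s)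
    (m : Fin s → ℕ) (tp : Fin s → ℂ) (htp : Function.Injective tp)
    (P : MvPolynomial (Fin (n+1)) ℂ) (hP : P ∈ linSys n d s m tp)
    (I : Finset (Fin s)) (t : ℕ) (u : Fin t → ℂ) (hu : Function.Injective u)
    (q : Fin (n+1) → ℂ)
    (hq : q ∈ Submodule.span ℂ
      (((fun i => rncPoint n (tp i)) '' (I : Set (Fin s))) ∪
        Set.range (fun j : Fin t => rncPoint n (u j))))
    (D : List (Fin (n+1)))
    (hD : (D.length : ℤ) <
      (∑ i ∈ I, (m i : ℤ)) + (t : ℤ) * kC n d s m - ((t : ℤ) + I.card - 1) * d) :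
    MvPolynomial.aeval q (derivAlong D P) = 0 := by
  obtain ⟨hhom, hvan⟩ := hP
  have hhom : P.IsHomogeneous d := hhom
  have hm : ∀ i, Van (rncPoint n (tp i)) (m i) P := by
    intro i
    rw [van_iff]
    intro D hD
    simp only [SetLike.mem_coe, Submodule.mem_iInf] at hvan
    exact hvan i D hD
  have hC : ∀ τ, Van (rncPoint n τ) (kC n d s m).toNat P := by
    intro τ
    apply van_spec
    rcases le_or_gt 0 (kC n d s m) with h | h
    · exact curve_van hs m tp htp hhom hm _ (Int.toNat_of_nonneg h).le
    · rw [Int.toNat_of_nonpos h.le]; trivial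
  rw [Submodule.span_union, Submodule.mem_sup] at hq
  obtain ⟨y, hy, z, hz, rfl⟩ := hq
  rw [Submodule.mem_span_image_finset_iff_exists_fun'] at hy
  rw [Submodule.mem_span_range_iff_exists_fun] at hz
  obtain ⟨c, rfl⟩ := hy
  obtain ⟨e, rfl⟩ := hz
  have h1 := join_sum I (fun i => rncPoint n (tp i)) c (fun i => (m i : ℤ)) hhom
    (fun i _ => by simpa using hm i) 0 d (by simpa using van_origin d P hhom)
  have h2 := join_sum Finset.univ (fun j => rncPoint n (u j)) e (fun _ => kC n d s m) hhom
    (fun j _ => hC (u j)) _ _ h1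
  rw [zero_add] at h2
  rw [van_iff] at h2
  refine h2 D ?_
  rw [Int.lt_toNat]
  refine hD.trans_eq ?_
  simp
  ring


end
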